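/- arXiv:2111.08778 — 2 statements merged into one kernel-verified Lean document; each statement's English description precedes it below -/
import Mathlib

section
/- Let p > 3 be a prime. Then p * ∑_{j=0}^{(p-3)/2} binom(2j,j)/4^j * (1 + p*H_{2j} − p*H_j)/(2j+1) ≡ (-1)^((p+1)/2) * p * q_p(2) + (-1)^((p+1)/2) * 2 * p^2 * q_p(2)^2 − p^2 * E_{p-3} modulo p^3, where the congruence is understood in the rational numbers. -/
/-- The Euler numbers, defined by the e.g.f. `2 * exp t / (exp (2*t) + 1)`,
equivalently by `E 0 = 1` and the recurrence coming from `cosh t * sech t = 1`. -/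
def eulerNumber : ℕ → ℚ
  | 0 => 1
  | n + 1 => -∑ k ∈ (Finset.range (n + 1)).attach,
      if (n + 1 - k.1) % 2 = 0 then ((n + 1).choose k.1 : ℚ) * eulerNumber k.1 else 0
  decreasing_by exact Finset.mem_range.mp k.2

open Finset Polynomial

/-! ### Congruences between rational numbers -/

/-- The ring of rational numbers whose denominator is coprime to `p`. -/
def pIntegral (p : ℕ) [hp : Fact p.Prime] : Subring ℚ where
  carrier := {x | ∃ a b : ℤ, ¬ (p : ℤ) ∣ b ∧ x = a / b}
  mul_mem' := by
    rintro _ _ ⟨a, b, hb, rfl⟩ ⟨c, d, hd, rfl⟩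
    refine ⟨a * c, b * d, fun h => ?_, by push_cast; rw [div_mul_div_comm]⟩
    exact ((Nat.prime_iff_prime_int.mp hp.out).dvd_or_dvd h).elim hb hd
  one_mem' := ⟨1, 1, fun h => (Nat.prime_iff_prime_int.mp hp.out).not_dvd_one h, by simp⟩
  add_mem' := by
    rintro _ _ ⟨a, b, hb, rfl⟩ ⟨c, d, hd, rfl⟩
    have hb0 : (b : ℚ) ≠ 0 := by rintro h; apply hb; simp [Int.cast_eq_zero.mp h]
    have hd0 : (d : ℚ) ≠ 0 := by rintro h; apply hd; simp [Int.cast_eq_zero.mp h]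
    refine ⟨a * d + b * c, b * d, fun h => ?_, by push_cast; rw [div_add_div _ _ hb0 hd0]⟩
    exact ((Nat.prime_iff_prime_int.mp hp.out).dvd_or_dvd h).elim hb hd
  zero_mem' := ⟨0, 1, fun h => (Nat.prime_iff_prime_int.mp hp.out).not_dvd_one h, by simp⟩
  neg_mem' := by
    rintro _ ⟨a, b, hb, rfl⟩
    exact ⟨-a, b, hb, by push_cast; ring⟩

/-- `x` and `y` are congruent modulo `p ^ r` in the ring of `p`-integral rational numbers. -/
def RatCong (p : ℕ) [Fact p.Prime] (r : ℕ) (x y : ℚ) : Prop :=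
  ∃ c ∈ pIntegral p, x - y = (p : ℚ) ^ r * c

section RatCong

variable {p : ℕ} [hp : Fact p.Prime] {r : ℕ} {x y z w : ℚ}

lemma inv_natCast_mem_pIntegral {k : ℕ} (h0 : 0 < k) (hk : k < p) :
    (k : ℚ)⁻¹ ∈ pIntegral p :=
  ⟨1, k, fun h => Nat.not_dvd_of_pos_of_lt h0 hk (Int.natCast_dvd_natCast.mp h), by simp⟩

lemma ratCast_natCast_ne_zero : (p : ℚ) ≠ 0 := Nat.cast_ne_zero.mpr hp.out.ne_zero

namespace RatCong

lemma refl (x : ℚ) : RatCong p r x x := ⟨0, zero_mem _, by simp⟩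

lemma of_eq (h : x = y) : RatCong p r x y := h ▸ refl x

lemma symm (h : RatCong p r x y) : RatCong p r y x := by
  obtain ⟨c, hc, h⟩ := h
  exact ⟨-c, neg_mem hc, by linear_combination -h⟩

lemma trans (h : RatCong p r x y) (h' : RatCong p r y z) : RatCong p r x z := by
  obtain ⟨c, hc, h⟩ := h
  obtain ⟨d, hd, h'⟩ := h'
  exact ⟨c + d, add_mem hc hd, by linear_combination h + h'⟩

lemma add (h : RatCong p r x y) (h' : RatCong p r z w) : RatCong p r (x + z) (y + w) := by
  obtain ⟨c, hc, h⟩ := h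
  obtain ⟨d, hd, h'⟩ := h'
  exact ⟨c + d, add_mem hc hd, by linear_combination h + h'⟩

lemma sub (h : RatCong p r x y) (h' : RatCong p r z w) : RatCong p r (x - z) (y - w) := by
  obtain ⟨c, hc, h⟩ := h
  obtain ⟨d, hd, h'⟩ := h'
  exact ⟨c - d, sub_mem hc hd, by linear_combination h - h'⟩

lemma mul_left (hz : z ∈ pIntegral p) (h : RatCong p r x y) : RatCong p r (z * x) (z * y) := by
  obtain ⟨c, hc, h⟩ := h
  exact ⟨z * c, mul_mem hz hc, by linear_combination z * h⟩

lemma mul (h : RatCong p r x y) (h' : RatCong p r z w) (hx : x ∈ pIntegral p)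
    (hw : w ∈ pIntegral p) : RatCong p r (x * z) (y * w) := by
  refine (h'.mul_left hx).trans ?_
  rw [mul_comm x, mul_comm y]
  exact h.mul_left hw

lemma prime_mul (h : RatCong p r x y) : RatCong p (r + 1) (p * x) (p * y) := by
  obtain ⟨c, hc, h⟩ := h
  exact ⟨c, hc, by rw [pow_succ]; linear_combination p * h⟩

lemma of_le {s : ℕ} (hs : s ≤ r) (h : RatCong p r x y) : RatCong p s x y := by
  obtain ⟨c, hc, h⟩ := h
  obtain ⟨t, rfl⟩ := Nat.exists_eq_add_of_le hs
  exact ⟨(p : ℚ) ^ t * c, mul_mem (pow_mem (natCast_mem _ p) _) hc, by rw [h, pow_add]; ring⟩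

lemma of_prime_mul (h : RatCong p (r + 1) (p * x) (p * y)) : RatCong p r x y := by
  obtain ⟨c, hc, h⟩ := h
  refine ⟨c, hc, mul_left_cancel₀ (ratCast_natCast_ne_zero (p := p)) ?_⟩
  rw [mul_sub, h, pow_succ]; ring

lemma inv (h : RatCong p r x y) (hx : x⁻¹ ∈ pIntegral p) (hy : y⁻¹ ∈ pIntegral p)
    (hx0 : x ≠ 0) (hy0 : y ≠ 0) : RatCong p r x⁻¹ y⁻¹ := by
  obtain ⟨c, hc, h⟩ := h
  refine ⟨-(x⁻¹ * y⁻¹ * c), neg_mem (mul_mem (mul_mem hx hy) hc), ?_⟩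
  field_simp
  linear_combination -h

lemma sum {ι : Type*} {s : Finset ι} {f g : ι → ℚ} (h : ∀ i ∈ s, RatCong p r (f i) (g i)) :
    RatCong p r (∑ i ∈ s, f i) (∑ i ∈ s, g i) := by
  classical
  induction s using Finset.induction_on with
  | empty => exact refl _
  | insert a s ha ih =>
    rw [sum_insert ha, sum_insert ha]
    exact (h a (mem_insert_self a s)).add (ih fun i hi => h i (mem_insert_of_mem hi))

lemma dvd_num (h : RatCong p r x y) : (p : ℤ) ^ r ∣ (x - y).num := by
  obtain ⟨_, ⟨a, b, hb, rfl⟩, h⟩ := h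
  have hb0 : (b : ℚ) ≠ 0 := by rintro h; apply hb; simp [Int.cast_eq_zero.mp h]
  have hcop : IsCoprime ((p : ℤ) ^ r) b :=
    ((Nat.prime_iff_prime_int.mp hp.out).coprime_iff_not_dvd.mpr hb).pow_left
  refine hcop.dvd_of_dvd_mul_right ⟨a * (x - y).den, ?_⟩
  have h1 : ((x - y).num : ℚ) = (x - y) * (x - y).den := (Rat.mul_den_eq_num _).symm
  have h2 : (((x - y).num * b : ℤ) : ℚ) = (((p : ℤ) ^ r * (a * (x - y).den) : ℤ) : ℚ) := by
    push_cast
    rw [h1]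
    nth_rewrite 1 [h]
    field_simp
  exact_mod_cast h2

end RatCong

/-- The reflection `k ↦ p - k` negates inverses modulo `p`. -/
lemma ratCong_inv_reflect {i j : ℕ} (hi : 0 < i) (hj : 0 < j) (hij : i + j = p) :
    RatCong p 1 (i : ℚ)⁻¹ (-(j : ℚ)⁻¹) := by
  refine ⟨(i : ℚ)⁻¹ * (j : ℚ)⁻¹, mul_mem (inv_natCast_mem_pIntegral hi (by omega))
    (inv_natCast_mem_pIntegral hj (by omega)), ?_⟩
  have : (p : ℚ) = i + j := by rw [← hij]; push_cast; ring
  rw [this]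
  field_simp
  ring

end RatCong

/-! ### Binomial sums -/

/-- Partial fractions: the alternating binomial transform of `1 / (x + j)`. -/
lemma sum_neg_one_pow_choose_div_add (m : ℕ) : ∀ x : ℚ, 0 < x →
    ∑ j ∈ range (m + 1), (-1) ^ j * (m.choose j : ℚ) / (x + j) =
      m.factorial / ∏ i ∈ range (m + 1), (x + i) := by
  induction m with
  | zero => intro x _; simp
  | succ m ih =>
    intro x hx
    have hprod : ∀ k : ℕ, ∏ i ∈ range k, (x + 1 + (i : ℚ)) ≠ 0 := fun k =>
      prod_ne_zero_iff.mpr fun i _ => by positivity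
    have key : ∑ j ∈ range (m + 2), (-1) ^ j * ((m + 1).choose j : ℚ) / (x + j) =
        ∑ j ∈ range (m + 1), (-1) ^ j * (m.choose j : ℚ) / (x + j) -
          ∑ j ∈ range (m + 1), (-1) ^ j * (m.choose j : ℚ) / (x + 1 + j) := by
      have h1 : ∑ j ∈ range (m + 1), (-1) ^ j * (m.choose j : ℚ) / (x + j) =
          ∑ j ∈ range (m + 2), (-1) ^ j * (m.choose j : ℚ) / (x + j) := by
        rw [sum_range_succ _ (m + 1)]; simp
      rw [h1, sum_range_succ' _ (m + 1), sum_range_succ' _ (m + 1), add_sub_right_comm,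
        ← sum_sub_distrib]
      congr 1
      · refine sum_congr rfl fun j _ => ?_
        rw [Nat.choose_succ_succ]
        push_cast
        rw [pow_succ, show x + 1 + (j : ℚ) = x + (j + 1) by ring]
        ring
      · simp
    rw [key, ih x hx, ih (x + 1) (by linarith)]
    have e1 : ∏ i ∈ range (m + 1), (x + (i : ℚ)) = x * ∏ i ∈ range m, (x + 1 + (i : ℚ)) := by
      rw [prod_range_succ', mul_comm]
      simp only [Nat.cast_add, Nat.cast_one, Nat.cast_zero, add_zero]
      congr 1
      exact prod_congr rfl fun i _ => by ring
    have e2 : ∏ i ∈ range (m + 2), (x + (i : ℚ)) =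
        x * ((∏ i ∈ range m, (x + 1 + (i : ℚ))) * (x + 1 + m)) := by
      rw [← prod_range_succ, prod_range_succ', mul_comm]
      simp only [Nat.cast_add, Nat.cast_one, Nat.cast_zero, add_zero]
      congr 1
      exact prod_congr rfl fun i _ => by ring
    rw [e2, e1, prod_range_succ, Nat.factorial_succ]
    have := hprod m
    have h3 : x + 1 + (m : ℚ) ≠ 0 := by positivity
    push_cast
    field_simp
    ring

/-- `C(2m, m) / 4 ^ m`. -/
def centralCoeff (m : ℕ) : ℚ := ((2 * m).choose m : ℚ) / 4 ^ m

lemma centralCoeff_zero : centralCoeff 0 = 1 := by simp [centralCoeff]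

lemma centralCoeff_succ (m : ℕ) :
    centralCoeff (m + 1) = centralCoeff m * ((2 * m + 1) / (2 * m + 2)) := by
  have h := Nat.succ_mul_centralBinom_succ m
  rw [Nat.centralBinom_eq_two_mul_choose, Nat.centralBinom_eq_two_mul_choose] at h
  have h' : ((m : ℚ) + 1) * ((2 * (m + 1)).choose (m + 1) : ℚ) =
      2 * (2 * m + 1) * ((2 * m).choose m : ℚ) := by exact_mod_cast h
  unfold centralCoeff
  rw [pow_succ]
  field_simp
  linear_combination 2 * h'

lemma centralCoeff_pos (m : ℕ) : 0 < centralCoeff m := by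
  have := Nat.centralBinom_pos m
  rw [Nat.centralBinom_eq_two_mul_choose] at this
  unfold centralCoeff
  positivity

lemma sum_neg_one_pow_choose_div_odd (m : ℕ) :
    ∑ j ∈ range (m + 1), (-1) ^ j * (m.choose j : ℚ) / (2 * j + 1) =
      ((2 * m + 1) * centralCoeff m)⁻¹ := by
  have h := sum_neg_one_pow_choose_div_add m (1 / 2) (by norm_num)
  have e : ∑ j ∈ range (m + 1), (-1) ^ j * (m.choose j : ℚ) / (2 * j + 1) =
      1 / 2 * ∑ j ∈ range (m + 1), (-1) ^ j * (m.choose j : ℚ) / (1 / 2 + j) := by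
    rw [mul_sum]
    refine sum_congr rfl fun j _ => ?_
    have : (0 : ℚ) < 1 / 2 + j := by positivity
    field_simp
    ring
  rw [e, h]
  clear e h
  induction m with
  | zero => simp [centralCoeff_zero]
  | succ m ih =>
    rw [prod_range_succ, Nat.factorial_succ, centralCoeff_succ]
    have := centralCoeff_pos m
    have h2 : (∏ i ∈ range (m + 1), (1 / 2 + (i : ℚ))) ≠ 0 :=
      prod_ne_zero_iff.mpr fun i _ => by positivity
    have h3 : (0 : ℚ) < 1 / 2 + (m + 1 : ℕ) := by positivity
    generalize ∏ i ∈ range (m + 1), (1 / 2 + (i : ℚ)) = P at ih h2 ⊢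
    push_cast at h3 ⊢
    field_simp at ih ⊢
    linear_combination (2 * m + 3 : ℚ) * ih

lemma sum_neg_one_pow_choose_div_succ (m : ℕ) :
    ∑ j ∈ range (m + 1), (-1) ^ j * (m.choose j : ℚ) / (j + 1) = 1 / (m + 1) := by
  have h := sum_neg_one_pow_choose_div_add m 1 one_pos
  simp_rw [add_comm (1 : ℚ)] at h
  rw [h]
  have : ∏ i ∈ range (m + 1), ((i : ℚ) + 1) = ((m + 1).factorial : ℚ) := by
    rw [← prod_range_add_one_eq_factorial]; push_cast; rfl
  rw [this, Nat.factorial_succ]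
  have := Nat.factorial_ne_zero m
  push_cast
  field_simp

/-- The binomial transform of a sequence in terms of its forward difference. -/
lemma sum_neg_one_pow_choose_succ_mul (m : ℕ) (a : ℕ → ℚ) :
    ∑ j ∈ range (m + 2), (-1) ^ j * ((m + 1).choose j : ℚ) * a j =
      -∑ j ∈ range (m + 1), (-1) ^ j * (m.choose j : ℚ) * (a (j + 1) - a j) := by
  have h1 : ∑ j ∈ range (m + 1), (-1) ^ j * (m.choose j : ℚ) * a j =
      ∑ j ∈ range (m + 2), (-1) ^ j * (m.choose j : ℚ) * a j := by
    rw [sum_range_succ _ (m + 1)]; simp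
  simp_rw [mul_sub]
  rw [sum_sub_distrib, h1, sum_range_succ' _ (m + 1), sum_range_succ' _ (m + 1), neg_sub,
    add_sub_right_comm, ← sum_sub_distrib]
  congr 1
  · refine sum_congr rfl fun j _ => ?_
    rw [Nat.choose_succ_succ]
    push_cast
    ring
  · simp

/-- Summation by parts for binomial transforms of `a j / j`. -/
lemma sum_neg_one_pow_choose_mul_div (n : ℕ) (a : ℕ → ℚ) :
    ∑ j ∈ range n, (-1) ^ (j + 1) * (n.choose (j + 1) : ℚ) * a (j + 1) / (j + 1) =
      ∑ k ∈ range n, (∑ j ∈ range (k + 2), (-1) ^ j * ((k + 1).choose j : ℚ) * a j - a 0) /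
        (k + 1) := by
  induction n with
  | zero => simp
  | succ n ih =>
    conv_rhs => rw [sum_range_succ _ n, ← ih, sum_range_succ' _ (n + 1)]
    have h1 : ∑ j ∈ range n, (-1) ^ (j + 1) * (n.choose (j + 1) : ℚ) * a (j + 1) / (j + 1) =
        ∑ j ∈ range (n + 1), (-1) ^ (j + 1) * (n.choose (j + 1) : ℚ) * a (j + 1) / (j + 1) := by
      rw [sum_range_succ _ n]; simp
    rw [h1]
    simp only [pow_zero, Nat.choose_zero_right, Nat.cast_one, mul_one, one_mul,
      add_sub_cancel_right]
    rw [sum_div, ← sum_add_distrib]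
    refine sum_congr rfl fun j _ => ?_
    have h2 : ((n : ℚ) + 1) * (n.choose j : ℚ) = ((n + 1).choose (j + 1) : ℚ) * (j + 1) := by
      exact_mod_cast Nat.add_one_mul_choose_eq n j
    have h3 : ((n + 1).choose (j + 1) : ℚ) = n.choose j + n.choose (j + 1) := by
      rw [Nat.choose_succ_succ]; push_cast; ring
    field_simp
    linear_combination a (j + 1) * ((n + 1 : ℚ) * h3 + h2)

lemma sum_neg_one_pow_choose_div (n : ℕ) :
    ∑ j ∈ range n, (-1) ^ (j + 1) * (n.choose (j + 1) : ℚ) / (j + 1) = -harmonic n := by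
  have h := sum_neg_one_pow_choose_mul_div n fun _ => 1
  simp_rw [mul_one] at h
  rw [h, harmonic, ← sum_neg_distrib]
  refine sum_congr rfl fun k _ => ?_
  have h0 := sum_neg_one_pow_choose_succ_mul k fun _ => 1
  simp only [mul_one, sub_self, mul_zero, sum_const_zero, neg_zero] at h0
  rw [h0]
  push_cast
  ring

lemma sum_neg_one_pow_choose_mul_harmonic_div (n : ℕ) :
    ∑ j ∈ range n, (-1) ^ (j + 1) * (n.choose (j + 1) : ℚ) * harmonic (j + 1) / (j + 1) =
      -∑ k ∈ range n, 1 / ((k : ℚ) + 1) ^ 2 := by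
  rw [sum_neg_one_pow_choose_mul_div, ← sum_neg_distrib]
  refine sum_congr rfl fun k _ => ?_
  rw [sum_neg_one_pow_choose_succ_mul]
  have h := sum_neg_one_pow_choose_div_succ k
  have : ∑ j ∈ range (k + 1), (-1) ^ j * (k.choose j : ℚ) * (harmonic (j + 1) - harmonic j) =
      1 / (k + 1) := by
    rw [← h]
    exact sum_congr rfl fun j _ => by rw [harmonic_succ]; push_cast; ring
  rw [this, harmonic_zero]
  field_simp
  ring

/-- The sum of `1 / (2k - 1)` for `1 ≤ k ≤ j`. -/
def oddHarmonic (j : ℕ) : ℚ := harmonic (2 * j) - harmonic j / 2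

lemma oddHarmonic_zero : oddHarmonic 0 = 0 := by simp [oddHarmonic]

lemma oddHarmonic_succ (j : ℕ) : oddHarmonic (j + 1) = oddHarmonic j + 1 / (2 * j + 1) := by
  unfold oddHarmonic
  rw [show 2 * (j + 1) = 2 * j + 1 + 1 by ring, harmonic_succ, harmonic_succ, harmonic_succ]
  push_cast
  field_simp
  ring

lemma sum_neg_one_pow_choose_mul_oddHarmonic_div (n : ℕ) :
    ∑ j ∈ range n, (-1) ^ (j + 1) * (n.choose (j + 1) : ℚ) * oddHarmonic (j + 1) / (j + 1) =
      -(1 / 2) * ∑ k ∈ range n, 1 / (((k : ℚ) + 1) ^ 2 * centralCoeff (k + 1)) := by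
  rw [sum_neg_one_pow_choose_mul_div, mul_sum]
  refine sum_congr rfl fun k _ => ?_
  rw [sum_neg_one_pow_choose_succ_mul]
  have : ∑ j ∈ range (k + 1), (-1) ^ j * (k.choose j : ℚ) *
      (oddHarmonic (j + 1) - oddHarmonic j) = ((2 * k + 1) * centralCoeff k)⁻¹ := by
    rw [← sum_neg_one_pow_choose_div_odd]
    exact sum_congr rfl fun j _ => by rw [oddHarmonic_succ]; ring
  rw [this, oddHarmonic_zero, centralCoeff_succ]
  have := centralCoeff_pos k
  field_simp
  ring

lemma sum_neg_one_pow_div_choose (M : ℕ) :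
    ∑ i ∈ range (M + 1), (-1) ^ i / (M.choose i : ℚ) =
      (1 + (-1) ^ M) * (M + 1) / (M + 2) := by
  have h : ∀ m ≤ M + 1, ∑ i ∈ range m, (-1) ^ i / (M.choose i : ℚ) =
      (M + 1) / (M + 2) * (1 - (-1) ^ m / ((M + 1).choose m : ℚ)) := by
    intro m
    induction m with
    | zero => intro _; simp
    | succ m ih =>
      intro hm
      rw [sum_range_succ, ih (by omega)]
      have h1 : (0 : ℚ) < M.choose m := by exact_mod_cast Nat.choose_pos (by omega)
      have h2 : (0 : ℚ) < (M + 1).choose m := by exact_mod_cast Nat.choose_pos (by omega)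
      have h3 : (0 : ℚ) < (M + 1).choose (m + 1) := by exact_mod_cast Nat.choose_pos (by omega)
      have e1 : ((M : ℚ) + 1) * (M.choose m : ℚ) = ((M + 1).choose (m + 1) : ℚ) * (m + 1) := by
        exact_mod_cast Nat.add_one_mul_choose_eq M m
      have e2 : ((M + 1).choose (m + 1) : ℚ) * (m + 1) = (M + 1).choose m * (M + 1 - m) := by
        have := Nat.choose_succ_right_eq (M + 1) m
        have hc : ((M + 1 - m : ℕ) : ℚ) = M + 1 - m := by
          rw [Nat.cast_sub (by omega)]; push_cast; ring
        rw [← hc]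
        exact_mod_cast this
      have hM : (0 : ℚ) < M + 1 - m := by
        have : (m : ℚ) + 1 ≤ M + 1 := by exact_mod_cast hm
        linarith
      have e3 : ((M + 1).choose m : ℚ) = (M + 1) * M.choose m / (M + 1 - m) := by
        rw [eq_div_iff hM.ne']; linarith
      have e4 : ((M + 1).choose (m + 1) : ℚ) = (M + 1) * M.choose m / (m + 1) := by
        rw [eq_div_iff (by positivity)]; linarith
      rw [e3, e4, pow_succ]
      field_simp
      ring
  rw [h (M + 1) le_rfl, Nat.choose_self, pow_succ]
  push_cast
  ring

lemma sum_neg_one_pow_div_sq_mul_choose (n : ℕ) :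
    ∑ k ∈ range n, (-1) ^ (k + 1) / (((k : ℚ) + 1) ^ 2 * (n.choose (k + 1) : ℚ)) =
      ∑ k ∈ range n, 1 / ((k : ℚ) + 1) ^ 2 +
        2 * ∑ k ∈ range n, (-1) ^ (k + 1) / ((k : ℚ) + 1) ^ 2 := by
  induction n with
  | zero => simp
  | succ n ih =>
    have step : ∑ k ∈ range n, (-1 : ℚ) ^ (k + 1) /
          (((k : ℚ) + 1) ^ 2 * ((n + 1).choose (k + 1) : ℚ)) =
        ∑ k ∈ range n, (-1 : ℚ) ^ (k + 1) / (((k : ℚ) + 1) ^ 2 * (n.choose (k + 1) : ℚ)) +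
          (1 - (-1 : ℚ) ^ n) / ((n : ℚ) + 1) ^ 2 := by
      rcases Nat.eq_zero_or_pos n with rfl | hn
      · simp
      obtain ⟨m, rfl⟩ := Nat.exists_eq_succ_of_ne_zero hn.ne'
      have h := sum_neg_one_pow_div_choose m
      have e : (1 - (-1 : ℚ) ^ (m + 1)) / (((m + 1 : ℕ) : ℚ) + 1) ^ 2 =
          ∑ i ∈ range (m + 1), (-1) ^ i / (m.choose i : ℚ) / ((m + 1) * (m + 2)) := by
        rw [← sum_div, h, pow_succ]
        push_cast
        field_simp
        ring
      rw [Nat.succ_eq_add_one, e, ← sum_add_distrib]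
      refine sum_congr rfl fun k hk => ?_
      have hk := mem_range.mp hk
      have h1 : (0 : ℚ) < m.choose k := by exact_mod_cast Nat.choose_pos (by omega)
      have h2 : (0 : ℚ) < (m + 1).choose (k + 1) := by exact_mod_cast Nat.choose_pos (by omega)
      have e1 : ((m : ℚ) + 1) * (m.choose k : ℚ) = ((m + 1).choose (k + 1) : ℚ) * (k + 1) := by
        exact_mod_cast Nat.add_one_mul_choose_eq m k
      have e2 : ((m + 1).choose (k + 1) : ℚ) * (m + 2) =
          ((m + 2).choose (k + 1) : ℚ) * (m + 1 - k) := by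
        have := Nat.choose_mul_succ_eq (m + 1) (k + 1)
        have hc : ((m + 1 + 1 - (k + 1) : ℕ) : ℚ) = m + 1 - k := by
          rw [Nat.cast_sub (by omega)]; push_cast; ring
        rw [← hc]
        exact_mod_cast this
      have hM : (0 : ℚ) < m + 1 - k := by
        have : (k : ℚ) + 1 ≤ m + 1 := by exact_mod_cast hk
        linarith
      have e3 : ((m + 1).choose (k + 1) : ℚ) = (m + 1) * m.choose k / (k + 1) := by
        rw [eq_div_iff (by positivity)]; linarith
      have e4 : ((m + 2).choose (k + 1) : ℚ) =
          (m + 1) * m.choose k / (k + 1) * (m + 2) / (m + 1 - k) := by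
        rw [eq_div_iff hM.ne', ← e3]; linarith
      rw [e3, e4, pow_succ]
      field_simp
      ring
    rw [sum_range_succ, step, ih, sum_range_succ _ n, sum_range_succ _ n, Nat.choose_self, pow_succ]
    push_cast
    field_simp
    ring

/-! ### Binomial coefficients and harmonic numbers modulo powers of `p` -/

lemma cast_eq_two_mul_add_one {p n : ℕ} (hn : p = 2 * n + 1) : (p : ℚ) = 2 * n + 1 := by
  exact_mod_cast hn

lemma signed_choose_succ {p n : ℕ} (hn : p = 2 * n + 1) {j : ℕ} (hj : j < n) :
    (-1) ^ (j + 1) * (n.choose (j + 1) : ℚ) =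
      (-1) ^ j * (n.choose j : ℚ) * ((2 * j + 1 - p) / (2 * j + 2)) := by
  have h : (n.choose (j + 1) : ℚ) * (j + 1) = n.choose j * (n - j) := by
    rw [← Nat.cast_sub hj.le]
    exact_mod_cast Nat.choose_succ_right_eq n j
  rw [cast_eq_two_mul_add_one hn]
  field_simp
  linear_combination 2 * (-1 : ℚ) ^ (j + 1) * h

lemma prod_one_sub_half_eq_centralCoeff {p n : ℕ} (hn : p = 2 * n + 1) :
    ∏ k ∈ range n, (1 - p * (1 / (2 * ((k : ℚ) + 1)))) = (-1) ^ n * centralCoeff n := by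
  have h1 : ∀ m : ℕ, centralCoeff m =
      (∏ k ∈ range m, (2 * (k : ℚ) + 1)) / ∏ k ∈ range m, (2 * ((k : ℚ) + 1)) := by
    intro m
    induction m with
    | zero => simp [centralCoeff_zero]
    | succ m ih =>
      rw [centralCoeff_succ, ih, prod_range_succ, prod_range_succ, div_mul_div_comm]
      ring
  rw [h1, ← prod_range_reflect (fun k : ℕ => 2 * (k : ℚ) + 1), ← prod_div_distrib]
  rw [show (-1 : ℚ) ^ n = ∏ _k ∈ range n, (-1 : ℚ) by simp, ← prod_mul_distrib]
  refine prod_congr rfl fun k hk => ?_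
  have := mem_range.mp hk
  rw [cast_eq_two_mul_add_one hn, Nat.sub_sub, Nat.cast_sub (by omega)]
  push_cast
  field_simp
  ring

lemma prod_one_sub_eq_choose {p n : ℕ} (hn : p = 2 * n + 1) :
    ∏ k ∈ range n, (1 - p * (1 / ((k : ℚ) + 1))) = (-1) ^ n * ((2 * n).choose n : ℚ) := by
  have h : ∀ m ≤ 2 * n, ∏ k ∈ range m, (1 - p * (1 / ((k : ℚ) + 1))) =
      (-1) ^ m * ((2 * n).choose m : ℚ) := by
    intro m
    induction m with
    | zero => simp
    | succ m ih =>
      intro hm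
      have h : ((2 * n).choose (m + 1) : ℚ) * (m + 1) = (2 * n).choose m * (2 * n - m) := by
        have := Nat.choose_succ_right_eq (2 * n) m
        have hc : ((2 * n - m : ℕ) : ℚ) = 2 * n - m := by
          rw [Nat.cast_sub (by omega)]; push_cast; ring
        rw [← hc]
        exact_mod_cast this
      rw [prod_range_succ, ih (by omega), cast_eq_two_mul_add_one hn, pow_succ]
      field_simp
      linear_combination h
  exact h n (by omega)

section Congruences

variable {p n : ℕ} [hp : Fact p.Prime]

lemma harmonic_mem_pIntegral {j : ℕ} (hj : j < p) : harmonic j ∈ pIntegral p :=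
  sum_mem fun i hi => inv_natCast_mem_pIntegral i.succ_pos (by have := mem_range.mp hi; omega)

lemma signed_choose_mem_pIntegral (m j : ℕ) : (-1) ^ j * (m.choose j : ℚ) ∈ pIntegral p :=
  mul_mem (pow_mem (neg_mem (one_mem _)) _) (natCast_mem _ _)

lemma pos_of_prime_eq (hn : p = 2 * n + 1) : 0 < n := by
  have := hp.out.one_lt
  omega

lemma inv_two_mem_pIntegral (hn : p = 2 * n + 1) : (2 : ℚ)⁻¹ ∈ pIntegral p := by
  have := pos_of_prime_eq hn
  exact_mod_cast inv_natCast_mem_pIntegral (p := p) two_pos (by omega)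

lemma oddHarmonic_mem_pIntegral (hn : p = 2 * n + 1) {j : ℕ} (hj : j ≤ n) :
    oddHarmonic j ∈ pIntegral p := by
  refine sub_mem (harmonic_mem_pIntegral (by omega)) ?_
  rw [div_eq_mul_inv]
  exact mul_mem (harmonic_mem_pIntegral (by omega)) (inv_two_mem_pIntegral hn)

lemma inv_two_mul_add_one_mem_pIntegral (hn : p = 2 * n + 1) {j : ℕ} (hj : j < n) :
    (2 * (j : ℚ) + 1)⁻¹ ∈ pIntegral p := by
  exact_mod_cast inv_natCast_mem_pIntegral (p := p) (k := 2 * j + 1) (by omega) (by omega)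

lemma inv_two_mul_add_two_mem_pIntegral (hn : p = 2 * n + 1) {j : ℕ} (hj : j < n) :
    (2 * (j : ℚ) + 2)⁻¹ ∈ pIntegral p := by
  exact_mod_cast inv_natCast_mem_pIntegral (p := p) (k := 2 * j + 2) (by omega) (by omega)

lemma inv_add_one_mem_pIntegral (hn : p = 2 * n + 1) {j : ℕ} (hj : j < n) :
    ((j : ℚ) + 1)⁻¹ ∈ pIntegral p := by
  exact_mod_cast inv_natCast_mem_pIntegral (p := p) (k := j + 1) (by omega) (by omega)

lemma centralCoeff_ratCong (hn : p = 2 * n + 1) {j : ℕ} (hj : j ≤ n) :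
    RatCong p 2 (centralCoeff j) ((-1) ^ j * (n.choose j : ℚ) * (1 + p * oddHarmonic j)) := by
  induction j with
  | zero => exact .of_eq (by simp [centralCoeff_zero, oddHarmonic_zero])
  | succ j ih =>
    obtain ⟨d, hd, h⟩ := ih (by omega)
    refine ⟨(2 * j + 2 : ℚ)⁻¹ * ((2 * j + 1) * d +
      (-1) ^ j * (n.choose j : ℚ) * oddHarmonic (j + 1)), ?_, ?_⟩
    · refine mul_mem (inv_two_mul_add_two_mem_pIntegral hn hj) (add_mem (mul_mem ?_ hd)
        (mul_mem (signed_choose_mem_pIntegral n j) (oddHarmonic_mem_pIntegral hn hj)))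
      exact_mod_cast natCast_mem (pIntegral p) (2 * j + 1)
    · rw [centralCoeff_succ, signed_choose_succ hn hj, oddHarmonic_succ]
      have hc : centralCoeff j = (-1) ^ j * (n.choose j : ℚ) * (1 + p * oddHarmonic j) +
        p ^ 2 * d := by linear_combination h
      rw [hc]
      field_simp
      ring

lemma centralCoeff_mem_pIntegral (hn : p = 2 * n + 1) {j : ℕ} (hj : j ≤ n) :
    centralCoeff j ∈ pIntegral p := by
  obtain ⟨d, hd, h⟩ := centralCoeff_ratCong hn hj
  rw [sub_eq_iff_eq_add.mp h]
  exact add_mem (mul_mem (pow_mem (natCast_mem _ _) _) hd)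
    (mul_mem (signed_choose_mem_pIntegral n j)
      (add_mem (one_mem _) (mul_mem (natCast_mem _ _) (oddHarmonic_mem_pIntegral hn hj))))

lemma centralCoeff_inv_mem_pIntegral (hn : p = 2 * n + 1) {j : ℕ} (hj : j ≤ n) :
    (centralCoeff j)⁻¹ ∈ pIntegral p := by
  induction j with
  | zero => simp [centralCoeff_zero, one_mem]
  | succ j ih =>
    rw [centralCoeff_succ, mul_inv, inv_div, div_eq_mul_inv]
    refine mul_mem (ih (by omega)) (mul_mem ?_ (inv_two_mul_add_one_mem_pIntegral hn hj))
    exact_mod_cast natCast_mem (pIntegral p) (2 * j + 2)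

lemma signed_choose_inv_mem_pIntegral (hn : p = 2 * n + 1) {j : ℕ} (hj : j ≤ n) :
    ((-1) ^ j * (n.choose j : ℚ))⁻¹ ∈ pIntegral p := by
  induction j with
  | zero => simp [one_mem]
  | succ j ih =>
    have e : ((2 * j + 1 - p) / (2 * j + 2) : ℚ)⁻¹ = -((j + 1 : ℕ) * ((n - j : ℕ) : ℚ)⁻¹) := by
      rw [cast_eq_two_mul_add_one hn, Nat.cast_sub (by omega)]
      have : (n : ℚ) - j ≠ 0 := sub_ne_zero.mpr (by exact_mod_cast (by omega : n ≠ j))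
      have h2 : 2 * (j : ℚ) + 1 - (2 * n + 1) = -(2 * (n - j)) := by ring
      rw [h2]
      push_cast
      field_simp
    rw [signed_choose_succ hn hj, mul_inv, e]
    exact mul_mem (ih (by omega)) (neg_mem (mul_mem (natCast_mem _ _)
      (inv_natCast_mem_pIntegral (by omega) (by omega))))

/-- The summand modulo `p ^ 2`. -/
lemma summand_ratCong (hn : p = 2 * n + 1) {j : ℕ} (hj : j < n) :
    RatCong p 2
      (centralCoeff j * (1 + (p : ℚ) * harmonic (2 * j) - (p : ℚ) * harmonic j) / (2 * j + 1))
      ((-1) ^ j * (n.choose j : ℚ) / (2 * j + 1) +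
        p * ((-1) ^ j * (n.choose j : ℚ) / (2 * j + 1) *
          (2 * oddHarmonic j - harmonic j / 2))) := by
  obtain ⟨d, hd, h⟩ := centralCoeff_ratCong hn hj.le
  have hO := oddHarmonic_mem_pIntegral hn hj.le
  have hD : oddHarmonic j - harmonic j * 2⁻¹ ∈ pIntegral p :=
    sub_mem hO (mul_mem (harmonic_mem_pIntegral (by omega)) (inv_two_mem_pIntegral hn))
  refine ⟨(2 * j + 1 : ℚ)⁻¹ * (d * (1 + p * (oddHarmonic j - harmonic j * 2⁻¹)) +
    (-1) ^ j * (n.choose j : ℚ) * (oddHarmonic j * (oddHarmonic j - harmonic j * 2⁻¹))), ?_, ?_⟩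
  · exact mul_mem (inv_two_mul_add_one_mem_pIntegral hn hj) (add_mem (mul_mem hd
      (add_mem (one_mem _) (mul_mem (natCast_mem _ _) hD)))
      (mul_mem (signed_choose_mem_pIntegral n j) (mul_mem hO hD)))
  · have e : harmonic (2 * j) = oddHarmonic j + harmonic j / 2 := by
      rw [oddHarmonic]; ring
    rw [sub_eq_iff_eq_add.mp h, e]
    field_simp
    ring

lemma sum_inv_sq_ratCong (hn : p = 2 * n + 1) (h3 : 3 < p) :
    RatCong p 1 (∑ k ∈ range n, 1 / ((k : ℚ) + 1) ^ 2) 0 := by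
  set g : ℕ → ℚ := fun k => ((k : ℚ)⁻¹) ^ 2 with hg
  have hrefl : ∀ i j : ℕ, 0 < i → 0 < j → i + j = p → RatCong p 1 (g i) (g j) := by
    intro i j hi hj hij
    have h := ratCong_inv_reflect hi hj hij
    have h' := h.mul h (inv_natCast_mem_pIntegral hi (by omega))
      (neg_mem (inv_natCast_mem_pIntegral hj (by omega)))
    convert h' using 1 <;> simp only [hg] <;> ring
  have heo : ∀ m : ℕ, ∑ k ∈ range (2 * m), g (k + 1) =
      ∑ k ∈ range m, g (2 * k + 1) + ∑ k ∈ range m, g (2 * k + 2) := by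
    intro m
    induction m with
    | zero => simp
    | succ m ih =>
      rw [show 2 * (m + 1) = 2 * m + 1 + 1 by ring, sum_range_succ, sum_range_succ, ih,
        sum_range_succ _ m, sum_range_succ _ m]
      ring
  have hodd : RatCong p 1 (∑ k ∈ range n, g (2 * k + 1)) (∑ k ∈ range n, g (2 * k + 2)) := by
    rw [← sum_range_reflect (fun k => g (2 * k + 2))]
    refine .sum fun k hk => hrefl _ _ (by omega) (by omega) ?_
    have := mem_range.mp hk
    omega
  have hupper : RatCong p 1 (∑ k ∈ range n, g (n + k + 1)) (∑ k ∈ range n, g (k + 1)) := by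
    rw [← sum_range_reflect (fun k => g (k + 1))]
    refine .sum fun k hk => hrefl _ _ (by omega) (by omega) ?_
    have := mem_range.mp hk
    omega
  have hsplit : ∑ k ∈ range (2 * n), g (k + 1) =
      ∑ k ∈ range n, g (k + 1) + ∑ k ∈ range n, g (n + k + 1) := by
    rw [two_mul, sum_range_add]
  have heven : ∑ k ∈ range n, g (2 * k + 2) = 1 / 4 * ∑ k ∈ range n, g (k + 1) := by
    rw [mul_sum]
    refine sum_congr rfl fun k _ => ?_
    simp only [hg]
    push_cast
    field_simp
    ring
  have hS : ∑ k ∈ range n, 1 / ((k : ℚ) + 1) ^ 2 = ∑ k ∈ range n, g (k + 1) :=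
    sum_congr rfl fun k _ => by simp [hg]
  rw [hS]
  rw [heven] at hodd
  have hall := (hodd.add (.refl (∑ k ∈ range n, g (2 * k + 2)))).symm
  rw [← heo, hsplit, heven] at hall
  obtain ⟨c, hc, hall⟩ := hall.trans ((RatCong.refl (∑ k ∈ range n, g (k + 1))).add hupper)
  have h3' : (3 : ℚ)⁻¹ ∈ pIntegral p := by
    exact_mod_cast inv_natCast_mem_pIntegral (p := p) (k := 3) (by omega) h3
  refine ⟨-(2 * (3 : ℚ)⁻¹ * c), neg_mem (mul_mem (mul_mem ?_ h3') hc), ?_⟩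
  · exact_mod_cast natCast_mem (pIntegral p) 2
  · linear_combination -(2 / 3 : ℚ) * hall

/-- Expansion of a product of factors `1 - p x` modulo `p ^ 3`. -/
lemma prod_one_sub_ratCong (hn : p = 2 * n + 1) (m : ℕ) (x : ℕ → ℚ)
    (hx : ∀ k < m, x k ∈ pIntegral p) :
    RatCong p 3 (∏ k ∈ range m, (1 - p * x k))
      (1 - p * ∑ k ∈ range m, x k +
        p ^ 2 * (((∑ k ∈ range m, x k) ^ 2 - ∑ k ∈ range m, x k ^ 2) / 2)) := by
  induction m with
  | zero => exact .of_eq (by simp)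
  | succ m ih =>
    obtain ⟨c, hc, h⟩ := ih fun k hk => hx k (by omega)
    have h1 : ∑ k ∈ range m, x k ∈ pIntegral p :=
      sum_mem fun k hk => hx k (by have := mem_range.mp hk; omega)
    have h2 : ∑ k ∈ range m, x k ^ 2 ∈ pIntegral p :=
      sum_mem fun k hk => pow_mem (hx k (by have := mem_range.mp hk; omega)) 2
    rw [prod_range_succ, sum_range_succ, sum_range_succ, sub_eq_iff_eq_add.mp h]
    refine ⟨c * (1 - p * x m) -
      x m * (((∑ k ∈ range m, x k) ^ 2 - ∑ k ∈ range m, x k ^ 2) * 2⁻¹), ?_, by ring⟩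
    exact sub_mem (mul_mem hc (sub_mem (one_mem _) (mul_mem (natCast_mem _ _) (hx m (by omega)))))
      (mul_mem (hx m (by omega)) (mul_mem (sub_mem (pow_mem h1 2) h2) (inv_two_mem_pIntegral hn)))

lemma signed_centralCoeff_ratCong_harmonic (hn : p = 2 * n + 1) (h3 : 3 < p) :
    RatCong p 3 ((-1) ^ n * centralCoeff n)
      (1 - p * (harmonic n / 2) + p ^ 2 * (harmonic n ^ 2 / 8)) := by
  have h := prod_one_sub_ratCong hn n (fun k => 1 / (2 * ((k : ℚ) + 1))) fun k hk => by
    rw [one_div, mul_inv]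
    exact mul_mem (inv_two_mem_pIntegral hn) (inv_add_one_mem_pIntegral hn hk)
  rw [prod_one_sub_half_eq_centralCoeff hn] at h
  refine h.trans ?_
  obtain ⟨c, hc, hs⟩ := sum_inv_sq_ratCong hn h3
  have e1 : ∑ k ∈ range n, 1 / (2 * ((k : ℚ) + 1)) = harmonic n / 2 := by
    rw [harmonic, sum_div]
    exact sum_congr rfl fun k _ => by push_cast; field_simp
  have e2 : ∑ k ∈ range n, (1 / (2 * ((k : ℚ) + 1))) ^ 2 =
      (∑ k ∈ range n, 1 / ((k : ℚ) + 1) ^ 2) / 4 := by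
    rw [sum_div]
    exact sum_congr rfl fun k _ => by field_simp; ring
  rw [e1, e2]
  refine ⟨-(c * 2⁻¹ ^ 3), neg_mem (mul_mem hc (pow_mem (inv_two_mem_pIntegral hn) 3)), ?_⟩
  linear_combination -(p ^ 2 / 8 : ℚ) * hs

lemma signed_choose_ratCong_harmonic (hn : p = 2 * n + 1) (h3 : 3 < p) :
    RatCong p 3 ((-1) ^ n * ((2 * n).choose n : ℚ))
      (1 - p * harmonic n + p ^ 2 * (harmonic n ^ 2 / 2)) := by
  have h := prod_one_sub_ratCong hn n (fun k => 1 / ((k : ℚ) + 1)) fun k hk => by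
    rw [one_div]
    exact inv_add_one_mem_pIntegral hn hk
  rw [prod_one_sub_eq_choose hn] at h
  refine h.trans ?_
  obtain ⟨c, hc, hs⟩ := sum_inv_sq_ratCong hn h3
  have e1 : ∑ k ∈ range n, 1 / ((k : ℚ) + 1) = harmonic n := by
    rw [harmonic]
    exact sum_congr rfl fun k _ => by push_cast; field_simp
  have e2 : ∑ k ∈ range n, (1 / ((k : ℚ) + 1)) ^ 2 = ∑ k ∈ range n, 1 / ((k : ℚ) + 1) ^ 2 :=
    sum_congr rfl fun k _ => by rw [div_pow, one_pow]
  rw [e1, e2]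
  refine ⟨-(c * 2⁻¹), neg_mem (mul_mem hc (inv_two_mem_pIntegral hn)), ?_⟩
  linear_combination -(p ^ 2 / 2 : ℚ) * hs

/-- Morley's congruence. -/
lemma signed_centralCoeff_ratCong (hn : p = 2 * n + 1) (h3 : 3 < p) :
    RatCong p 3 ((-1) ^ n * centralCoeff n) (4 ^ n) := by
  have hA := signed_centralCoeff_ratCong_harmonic hn h3
  have hB := signed_choose_ratCong_harmonic hn h3
  have h2 := inv_two_mem_pIntegral hn
  have hsign : (-1 : ℚ) ^ n ∈ pIntegral p := pow_mem (neg_mem (one_mem _)) _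
  have hAm : (-1) ^ n * centralCoeff n ∈ pIntegral p :=
    mul_mem hsign (centralCoeff_mem_pIntegral hn le_rfl)
  have hh : harmonic n ∈ pIntegral p := harmonic_mem_pIntegral (by omega)
  have hpm : (p : ℚ) ∈ pIntegral p := natCast_mem _ _
  have hm : 1 - p * (harmonic n / 2) + p ^ 2 * (harmonic n ^ 2 / 8) ∈ pIntegral p := by
    rw [show (8 : ℚ) = 2 ^ 3 by norm_num, div_eq_mul_inv, div_eq_mul_inv, ← inv_pow]
    exact add_mem (sub_mem (one_mem _) (mul_mem hpm (mul_mem hh h2)))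
      (mul_mem (pow_mem hpm 2) (mul_mem (pow_mem hh 2) (pow_mem h2 3)))
  have hsq := hA.mul hA hAm hm
  have hsq' : RatCong p 3
      ((1 - p * (harmonic n / 2) + p ^ 2 * (harmonic n ^ 2 / 8)) *
        (1 - p * (harmonic n / 2) + p ^ 2 * (harmonic n ^ 2 / 8)))
      (1 - p * harmonic n + p ^ 2 * (harmonic n ^ 2 / 2)) := by
    refine ⟨-(harmonic n ^ 3 * 2⁻¹ ^ 3) + p * (harmonic n ^ 4 * 2⁻¹ ^ 6), ?_, by ring⟩
    exact add_mem (neg_mem (mul_mem (pow_mem hh 3) (pow_mem h2 3)))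
      (mul_mem hpm (mul_mem (pow_mem hh 4) (pow_mem h2 6)))
  have hAB := (hsq.trans hsq').trans hB.symm
  have hpos := (centralCoeff_pos n).ne'
  have hcancel := hAB.mul_left (mul_mem hsign (centralCoeff_inv_mem_pIntegral hn le_rfl))
  have hs : ((-1 : ℚ) ^ n) ^ 2 = 1 := by rw [← pow_mul, mul_comm, pow_mul]; simp
  have e1 : (-1) ^ n * (centralCoeff n)⁻¹ *
      ((-1) ^ n * centralCoeff n * ((-1) ^ n * centralCoeff n)) = (-1) ^ n * centralCoeff n := by
    field_simp
    linear_combination hs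
  have e2 : (-1) ^ n * (centralCoeff n)⁻¹ * ((-1) ^ n * ((2 * n).choose n : ℚ)) = 4 ^ n := by
    have : ((2 * n).choose n : ℚ) = 4 ^ n * centralCoeff n := by
      rw [centralCoeff]; field_simp
    rw [this]
    field_simp
    linear_combination hs
  rwa [e1, e2] at hcancel

/-- The Fermat quotient in terms of the harmonic number `H_n`. -/
lemma fermatQuotient_ratCong (hn : p = 2 * n + 1) (h3 : 3 < p) {q : ℚ}
    (hq : (4 : ℚ) ^ n = 1 + p * q) : RatCong p 1 q (-(harmonic n / 2)) := by
  have h := ((signed_centralCoeff_ratCong hn h3).symm.trans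
    (signed_centralCoeff_ratCong_harmonic hn h3)).sub (.refl 1)
  obtain ⟨c, hc, h⟩ : RatCong p 2 q (-(harmonic n / 2) + p * (harmonic n ^ 2 / 8)) := by
    refine .of_prime_mul ?_
    convert h using 1
    · rw [hq]; ring
    · ring
  refine ⟨harmonic n ^ 2 * 2⁻¹ ^ 3 + p * c, ?_, by linear_combination h⟩
  exact add_mem (mul_mem (pow_mem (harmonic_mem_pIntegral (by omega)) 2)
    (pow_mem (inv_two_mem_pIntegral hn) 3)) (mul_mem (natCast_mem _ _) hc)

lemma fermatQuotient_mem_pIntegral (hn : p = 2 * n + 1) (h3 : 3 < p) {q : ℚ}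
    (hq : (4 : ℚ) ^ n = 1 + p * q) : q ∈ pIntegral p := by
  obtain ⟨c, hc, h⟩ := fermatQuotient_ratCong hn h3 hq
  rw [sub_eq_iff_eq_add.mp h, div_eq_mul_inv]
  exact add_mem (mul_mem (pow_mem (natCast_mem _ _) _) hc)
    (neg_mem (mul_mem (harmonic_mem_pIntegral (by omega)) (inv_two_mem_pIntegral hn)))

lemma sum_signed_choose_div_odd_ratCong (hn : p = 2 * n + 1) (h3 : 3 < p) {q : ℚ}
    (hq : (4 : ℚ) ^ n = 1 + p * q) :
    RatCong p 2 (∑ j ∈ range n, (-1) ^ j * (n.choose j : ℚ) / (2 * j + 1))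
      ((-1) ^ n * (-q + p * q ^ 2)) := by
  have hqm := fermatQuotient_mem_pIntegral hn h3 hq
  have hpm : (p : ℚ) ∈ pIntegral p := natCast_mem _ _
  have hsign : (-1 : ℚ) ^ n ∈ pIntegral p := pow_mem (neg_mem (one_mem _)) _
  obtain ⟨e, he, hA⟩ := signed_centralCoeff_ratCong hn h3
  have hsum := sum_neg_one_pow_choose_div_odd n
  rw [sum_range_succ, ← cast_eq_two_mul_add_one hn, Nat.choose_self] at hsum
  have hp0 : (p : ℚ) ≠ 0 := ratCast_natCast_ne_zero
  have hpos := (centralCoeff_pos n).ne'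
  have hs : ((-1 : ℚ) ^ n) ^ 2 = 1 := by rw [← pow_mul, mul_comm, pow_mul]; simp
  refine .of_prime_mul ⟨-((centralCoeff n)⁻¹ * (q ^ 3 + e * (1 - p * q + p ^ 2 * q ^ 2))), ?_, ?_⟩
  · exact neg_mem (mul_mem (centralCoeff_inv_mem_pIntegral hn le_rfl) (add_mem (pow_mem hqm 3)
      (mul_mem he (add_mem (sub_mem (one_mem _) (mul_mem hpm hqm))
        (mul_mem (pow_mem hpm 2) (pow_mem hqm 2))))))
  · rw [eq_sub_of_add_eq hsum]
    rw [hq] at hA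
    field_simp
    push_cast
    linear_combination (-(1 - p * q + p ^ 2 * q ^ 2) : ℚ) * hA

/-- Reflection of odd harmonic numbers. -/
lemma oddHarmonic_ratCong_reflect (hn : p = 2 * n + 1) (i : ℕ) : ∀ j, i + j = n →
    RatCong p 1 (oddHarmonic i) ((harmonic j - harmonic n) / 2) := by
  induction i with
  | zero =>
    rintro j hj
    exact .of_eq (by rw [← hj, oddHarmonic_zero]; simp)
  | succ i ih =>
    intro j hj
    have h := (ih (j + 1) (by omega)).add
      (ratCong_inv_reflect (p := p) (i := 2 * i + 1) (j := 2 * (j + 1)) (by omega) (by omega)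
        (by omega))
    convert h using 1
    · rw [oddHarmonic_succ]; push_cast; ring
    · rw [harmonic_succ]; push_cast; field_simp; ring

lemma harmonic_ratCong_reflect (hn : p = 2 * n + 1) {i j : ℕ} (hij : i + j = n) :
    RatCong p 1 (harmonic i) (2 * oddHarmonic j + harmonic n) := by
  have h := ((oddHarmonic_ratCong_reflect hn j i (by omega)).mul_left
    (natCast_mem (pIntegral p) 2)).add (.refl (harmonic n))
  convert h.symm using 1 <;> push_cast <;> ring

lemma sum_inv_sq_mul_centralCoeff_ratCong (hn : p = 2 * n + 1) (h3 : 3 < p) :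
    RatCong p 1 (∑ k ∈ range n, 1 / (((k : ℚ) + 1) ^ 2 * centralCoeff (k + 1)))
      (2 * ∑ k ∈ range n, (-1) ^ (k + 1) / ((k : ℚ) + 1) ^ 2) := by
  have h := (sum_inv_sq_ratCong hn h3).add
    (.refl (2 * ∑ k ∈ range n, (-1) ^ (k + 1) / ((k : ℚ) + 1) ^ 2))
  rw [← sum_neg_one_pow_div_sq_mul_choose, zero_add] at h
  refine RatCong.trans (.sum fun k hk => ?_) h
  have hk : k + 1 ≤ n := mem_range.mp hk
  have hb : RatCong p 1 (centralCoeff (k + 1)) ((-1) ^ (k + 1) * (n.choose (k + 1) : ℚ)) := by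
    refine ((centralCoeff_ratCong hn hk).of_le one_le_two).trans
      ⟨(-1) ^ (k + 1) * (n.choose (k + 1) : ℚ) * oddHarmonic (k + 1), ?_, by ring⟩
    exact mul_mem (signed_choose_mem_pIntegral n _) (oddHarmonic_mem_pIntegral hn hk)
  have hchoose : (n.choose (k + 1) : ℚ) ≠ 0 := by
    exact_mod_cast (Nat.choose_pos (by omega)).ne'
  have hinv := (hb.inv (centralCoeff_inv_mem_pIntegral hn hk)
    (signed_choose_inv_mem_pIntegral hn hk) (centralCoeff_pos _).ne'
    (mul_ne_zero (pow_ne_zero _ (by norm_num)) hchoose)).mul_left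
    (pow_mem (inv_add_one_mem_pIntegral hn hk) 2)
  convert hinv using 1
  · rw [one_div, mul_inv, inv_pow]
  · have hs : ((-1 : ℚ) ^ (k + 1))⁻¹ = (-1) ^ (k + 1) := by rw [← inv_pow]; norm_num
    rw [mul_inv, hs, inv_pow, div_eq_mul_inv, mul_inv]
    ring

/-- The contribution of first order in `p` to the sum. -/
lemma sum_signed_choose_mul_harmonic_ratCong (hn : p = 2 * n + 1) (h3 : 3 < p) {q : ℚ}
    (hq : (4 : ℚ) ^ n = 1 + p * q) :
    RatCong p 1
      (∑ j ∈ range n, (-1) ^ j * (n.choose j : ℚ) / (2 * j + 1) *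
        (2 * oddHarmonic j - harmonic j / 2))
      (-(-1) ^ n * (3 * q ^ 2 + (∑ k ∈ range n, (-1) ^ (k + 1) / ((k : ℚ) + 1) ^ 2) / 2)) := by
  have h2 := inv_two_mem_pIntegral hn
  have hsign : (-1 : ℚ) ^ n ∈ pIntegral p := pow_mem (neg_mem (one_mem _)) _
  have hHn : harmonic n ∈ pIntegral p := harmonic_mem_pIntegral (by omega)
  have hrefl : RatCong p 1
      (∑ j ∈ range n, (-1) ^ j * (n.choose j : ℚ) / (2 * j + 1) *
        (2 * oddHarmonic j - harmonic j / 2))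
      (∑ k ∈ range n, (-1) ^ n * ((-1) ^ (k + 1) * (n.choose (k + 1) : ℚ)) *
        (-((2 * (k + 1) : ℕ) : ℚ)⁻¹ * (harmonic (k + 1) - oddHarmonic (k + 1) -
          3 / 2 * harmonic n))) := by
    rw [← sum_range_reflect]
    refine .sum fun k hk => ?_
    have hk := mem_range.mp hk
    obtain ⟨i, hi⟩ : ∃ i, n - 1 - k = i := ⟨_, rfl⟩
    have hin : i + (k + 1) = n := by omega
    rw [hi]
    have hchoose : (-1) ^ i * (n.choose i : ℚ) =
        (-1) ^ n * ((-1) ^ (k + 1) * (n.choose (k + 1) : ℚ)) := by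
      rw [← Nat.choose_symm_of_eq_add (n := n) (a := i) (b := k + 1) hin.symm]
      have : (-1 : ℚ) ^ i = (-1) ^ n * (-1) ^ (k + 1) := by
        rw [← hin, pow_add, mul_assoc, ← pow_add, Even.neg_one_pow ⟨k + 1, rfl⟩, mul_one]
      rw [this]
      ring
    have hdiv := ratCong_inv_reflect (p := p) (i := 2 * i + 1) (j := 2 * (k + 1))
      (by omega) (by omega) (by omega)
    have hharm : RatCong p 1 (2 * oddHarmonic i - harmonic i / 2)
        (harmonic (k + 1) - oddHarmonic (k + 1) - 3 / 2 * harmonic n) := by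
      have ho := (oddHarmonic_ratCong_reflect hn i (k + 1) hin).mul_left
        (natCast_mem (pIntegral p) 2)
      have hh := (harmonic_ratCong_reflect hn hin).mul_left h2
      convert ho.sub hh using 1 <;> push_cast <;> ring
    have hbm := signed_choose_mem_pIntegral (p := p) n i
    have hmul := (hdiv.mul hharm (inv_natCast_mem_pIntegral (by omega) (by omega))
      (sub_mem (sub_mem (harmonic_mem_pIntegral (by omega)) (oddHarmonic_mem_pIntegral hn hk))
        (mul_mem (by
          rw [div_eq_mul_inv]
          exact mul_mem (natCast_mem (pIntegral p) 3) h2) hHn))).mul_left hbm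
    rw [← hchoose]
    convert hmul using 1
    push_cast
    ring
  refine hrefl.trans ?_
  have heval : ∑ k ∈ range n, (-1) ^ n * ((-1) ^ (k + 1) * (n.choose (k + 1) : ℚ)) *
        (-((2 * (k + 1) : ℕ) : ℚ)⁻¹ * (harmonic (k + 1) - oddHarmonic (k + 1) -
          3 / 2 * harmonic n)) =
      (-1) ^ n * 2⁻¹ * (-(2⁻¹ * ∑ k ∈ range n, 1 / (((k : ℚ) + 1) ^ 2 * centralCoeff (k + 1))) +
        ∑ k ∈ range n, 1 / ((k : ℚ) + 1) ^ 2 - 3 * 2⁻¹ * (harmonic n * harmonic n)) := by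
    have hO := sum_neg_one_pow_choose_mul_oddHarmonic_div n
    have hH := sum_neg_one_pow_choose_mul_harmonic_div n
    have h1 := sum_neg_one_pow_choose_div n
    have e : ∑ k ∈ range n, (-1) ^ n * ((-1) ^ (k + 1) * (n.choose (k + 1) : ℚ)) *
        (-((2 * (k + 1) : ℕ) : ℚ)⁻¹ * (harmonic (k + 1) - oddHarmonic (k + 1) -
          3 / 2 * harmonic n)) =
      (-1) ^ n * 2⁻¹ *
        (∑ j ∈ range n, (-1) ^ (j + 1) * (n.choose (j + 1) : ℚ) * oddHarmonic (j + 1) / (j + 1) -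
          ∑ j ∈ range n, (-1) ^ (j + 1) * (n.choose (j + 1) : ℚ) * harmonic (j + 1) / (j + 1) +
          3 / 2 * harmonic n *
            ∑ j ∈ range n, (-1) ^ (j + 1) * (n.choose (j + 1) : ℚ) / (j + 1)) := by
      rw [mul_sum, ← sum_sub_distrib, ← sum_add_distrib, mul_sum]
      refine sum_congr rfl fun k _ => ?_
      push_cast
      field_simp
      ring
    rw [e, hO, hH, h1]
    ring
  rw [heval]
  have hqm := fermatQuotient_mem_pIntegral hn h3 hq
  have hHq : RatCong p 1 (harmonic n) (-(2 * q)) := by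
    have h := (fermatQuotient_ratCong hn h3 hq).symm.mul_left
      (neg_mem (natCast_mem (pIntegral p) 2))
    convert h using 1 <;> push_cast <;> ring
  have hHq2 := (hHq.mul hHq hHn
    (neg_mem (mul_mem (natCast_mem (pIntegral p) 2) hqm))).mul_left
    (mul_mem (natCast_mem (pIntegral p) 3) h2)
  have hG := (sum_inv_sq_mul_centralCoeff_ratCong hn h3).mul_left (neg_mem h2)
  have htotal := ((hG.add (sum_inv_sq_ratCong hn h3)).sub hHq2).mul_left (mul_mem hsign h2)
  convert htotal using 1
  · push_cast
    ring
  · push_cast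
    ring

end Congruences

/-! ### Euler numbers -/

lemma eulerNumber_succ (n : ℕ) : eulerNumber (n + 1) =
    -∑ k ∈ range (n + 1),
      if (n + 1 - k) % 2 = 0 then ((n + 1).choose k : ℚ) * eulerNumber k else 0 := by
  rw [eulerNumber]
  exact congrArg _ (sum_attach (range (n + 1)) fun k =>
    if (n + 1 - k) % 2 = 0 then ((n + 1).choose k : ℚ) * eulerNumber k else 0)

lemma eulerNumber_mem_pIntegral (p : ℕ) [Fact p.Prime] (n : ℕ) : eulerNumber n ∈ pIntegral p := by
  induction n using Nat.strong_induction_on with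
  | _ n ih =>
    cases n with
    | zero => rw [eulerNumber]; exact one_mem _
    | succ n =>
      rw [eulerNumber_succ]
      refine neg_mem (sum_mem fun k hk => ?_)
      split_ifs
      · exact mul_mem (natCast_mem _ _) (ih k (mem_range.mp hk))
      · exact zero_mem _

lemma sum_choose_mul_eulerNumber (r : ℕ) :
    ∑ k ∈ range (r + 1), (r.choose k : ℚ) * eulerNumber k * (1 + (-1) ^ (r - k)) =
      if r = 0 then 2 else 0 := by
  cases r with
  | zero => simp [eulerNumber]; norm_num
  | succ r =>
    rw [sum_range_succ, eulerNumber_succ, if_neg r.succ_ne_zero]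
    have : ∑ k ∈ range (r + 1), ((r + 1).choose k : ℚ) * eulerNumber k * (1 + (-1) ^ (r + 1 - k)) =
        2 * ∑ k ∈ range (r + 1),
          if (r + 1 - k) % 2 = 0 then ((r + 1).choose k : ℚ) * eulerNumber k else 0 := by
      rw [mul_sum]
      refine sum_congr rfl fun k _ => ?_
      split_ifs with h
      · rw [(Nat.even_iff.mpr h).neg_one_pow]; ring
      · rw [(Nat.odd_iff.mpr (by omega : (r + 1 - k) % 2 = 1)).neg_one_pow]; ring
    rw [this]
    simp
    ring

/-- The umbral functional sending `X ^ k` to the Euler number `E_k`. -/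
noncomputable def eulerFunctional : ℚ[X] →ₗ[ℚ] ℚ :=
  Polynomial.lsum fun k => eulerNumber k • LinearMap.id

lemma eulerFunctional_C_mul_X_pow (a : ℚ) (k : ℕ) :
    eulerFunctional (C a * X ^ k) = a * eulerNumber k := by
  rw [eulerFunctional, Polynomial.lsum_apply, C_mul_X_pow_eq_monomial,
    sum_monomial_index _ _ (by simp)]
  simp [mul_comm]

lemma eulerFunctional_X_add_C_pow (m : ℕ) (x : ℚ) :
    eulerFunctional ((X + C x) ^ m) =
      ∑ k ∈ range (m + 1), (m.choose k : ℚ) * eulerNumber k * x ^ (m - k) := by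
  rw [add_pow, map_sum]
  refine sum_congr rfl fun k _ => ?_
  have : (X ^ k * C x ^ (m - k) * (m.choose k : ℚ[X]) : ℚ[X]) =
      C (x ^ (m - k) * (m.choose k : ℚ)) * X ^ k := by
    simp only [map_mul, map_pow, map_natCast]
    ring
  rw [this, eulerFunctional_C_mul_X_pow]
  ring

lemma eulerFunctional_comp_add (P : ℚ[X]) :
    eulerFunctional (P.comp (X + C 1)) + eulerFunctional (P.comp (X + C (-1))) =
      2 * P.eval 0 := by
  induction P using Polynomial.induction_on' with
  | add P Q hP hQ =>
    rw [add_comp, add_comp, map_add, map_add, eval_add]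
    linear_combination hP + hQ
  | monomial r a =>
    rw [← C_mul_X_pow_eq_monomial]
    simp only [mul_comp, C_comp, pow_comp, X_comp]
    simp only [← smul_eq_C_mul, map_smul]
    rw [eulerFunctional_X_add_C_pow, eulerFunctional_X_add_C_pow, ← smul_add, ← sum_add_distrib]
    have h := sum_choose_mul_eulerNumber r
    simp only [one_pow, mul_one, ← mul_one_add] at h ⊢
    rw [h, eval_smul, eval_pow, eval_X]
    rcases eq_or_ne r 0 with rfl | hr
    · simp; ring
    · simp [hr]

lemma eulerFunctional_shift (m : ℕ) (x : ℚ) :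
    eulerFunctional ((X + C (x + 1)) ^ m) + eulerFunctional ((X + C (x - 1)) ^ m) =
      2 * x ^ m := by
  have h := eulerFunctional_comp_add ((X + C x) ^ m)
  simp only [pow_comp, add_comp, X_comp, C_comp, eval_pow, eval_add, eval_X, eval_C,
    zero_add] at h
  rw [← h, add_assoc, ← C_add, add_assoc, ← C_add, add_comm 1 x, neg_add_eq_sub]

lemma two_mul_sum_neg_one_pow_mul_pow (m N : ℕ) (a : ℚ) :
    2 * ∑ i ∈ range N, (-1) ^ i * (a + 2 * i + 1) ^ m =
      eulerFunctional ((X + C a) ^ m) - (-1) ^ N * eulerFunctional ((X + C (a + 2 * N)) ^ m) := by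
  induction N with
  | zero => simp
  | succ N ih =>
    have h := eulerFunctional_shift m (a + 2 * N + 1)
    rw [add_sub_cancel_right, show a + 2 * (N : ℚ) + 1 + 1 = a + 2 * (N + 1 : ℕ) by
      push_cast; ring] at h
    rw [sum_range_succ, mul_add, ih, pow_succ]
    linear_combination -(-1 : ℚ) ^ N * h

section EulerCongruence

variable {p : ℕ} [hp : Fact p.Prime]

lemma eulerFunctional_ratCong (m : ℕ) {u : ℚ} (hu : u ∈ pIntegral p) :
    RatCong p 1 (eulerFunctional ((X + C (p * u)) ^ m)) (eulerNumber m) := by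
  rw [eulerFunctional_X_add_C_pow, sum_range_succ]
  simp only [Nat.choose_self, Nat.cast_one, one_mul, Nat.sub_self, pow_zero, mul_one]
  have hpu : (p : ℚ) * u ∈ pIntegral p := mul_mem (natCast_mem _ _) hu
  refine ⟨∑ k ∈ range m, (m.choose k : ℚ) * eulerNumber k * (u * (p * u) ^ (m - k - 1)), ?_, ?_⟩
  · exact sum_mem fun k _ => mul_mem (mul_mem (natCast_mem _ _) (eulerNumber_mem_pIntegral p k))
      (mul_mem hu (pow_mem hpu _))
  · rw [add_sub_cancel_right, pow_one, mul_sum]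
    refine sum_congr rfl fun k hk => ?_
    obtain ⟨t, ht⟩ : ∃ t, m - k = t + 1 :=
      Nat.exists_eq_succ_of_ne_zero (Nat.sub_ne_zero_of_lt (mem_range.mp hk))
    rw [ht, Nat.add_sub_cancel, pow_succ]
    ring

lemma natCast_pow_sub_three_ratCong (h3 : 3 < p) {k : ℕ} (h0 : 0 < k) (hk : k < p) :
    RatCong p 1 ((k : ℚ) ^ (p - 3)) ((k : ℚ)⁻¹ ^ 2) := by
  have hcop : IsCoprime (k : ℤ) p := by
    rw [Nat.isCoprime_iff_coprime]
    exact (hp.out.coprime_iff_not_dvd.mpr (Nat.not_dvd_of_pos_of_lt h0 hk)).symm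
  obtain ⟨c, hc⟩ := (Int.ModEq.pow_card_sub_one_eq_one hp.out hcop).symm.dvd
  have hc' : (k : ℚ) ^ (p - 1) - 1 = p * c := by exact_mod_cast hc
  refine ⟨c * (k : ℚ)⁻¹ ^ 2, mul_mem (intCast_mem _ _)
    (pow_mem (inv_natCast_mem_pIntegral h0 hk) 2), ?_⟩
  have hk0 : (k : ℚ) ≠ 0 := by exact_mod_cast h0.ne'
  rw [show p - 1 = p - 3 + 2 by omega, pow_add] at hc'
  field_simp
  linear_combination hc'

/-- `E_{p-3}` as an alternating sum of inverse squares. -/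
lemma eulerNumber_sub_three_ratCong {n : ℕ} (hn : p = 2 * n + 1) (h3 : 3 < p) :
    RatCong p 1 (eulerNumber (p - 3))
      ((-1) ^ n * ((∑ k ∈ range n, (-1) ^ (k + 1) / ((k : ℚ) + 1) ^ 2) / 2)) := by
  have h2 := inv_two_mem_pIntegral hn
  have htel := two_mul_sum_neg_one_pow_mul_pow (p - 3) p (-p)
  rw [show (-p + 2 * p : ℚ) = p * 1 by ring, show (-p : ℚ) = p * (-1) by ring,
    Odd.neg_one_pow (⟨n, hn⟩ : Odd p)] at htel
  have hE := ((eulerFunctional_ratCong (p - 3) (neg_mem (one_mem (pIntegral p)))).add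
    (eulerFunctional_ratCong (p - 3) (one_mem (pIntegral p)))).mul_left h2
  have hsum : ∑ i ∈ range p, (-1 : ℚ) ^ i * ((p : ℚ) * (-1) + 2 * i + 1) ^ (p - 3) =
      (-1) ^ n * ∑ k ∈ range n, (-1) ^ (k + 1) * 2 * ((2 * (k + 1) : ℕ) : ℚ) ^ (p - 3) := by
    have heven : Even (p - 3) := ⟨n - 1, by omega⟩
    obtain ⟨m, hm⟩ : ∃ m, p - 3 = m := ⟨_, rfl⟩
    rw [hm] at heven ⊢
    rw [cast_eq_two_mul_add_one hn, hn, show 2 * n + 1 = n + 1 + n by ring, sum_range_add,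
      sum_range_succ, ← sum_range_reflect, mul_sum]
    have hmid : (-1 : ℚ) ^ n * ((2 * n + 1) * (-1) + 2 * n + 1) ^ m = 0 := by
      rw [show (2 * n + 1) * (-1) + 2 * n + 1 = (0 : ℚ) by ring, zero_pow (by omega), mul_zero]
    rw [hmid, add_zero, ← sum_add_distrib]
    refine sum_congr rfl fun k hk => ?_
    have hk := mem_range.mp hk
    obtain ⟨i, hi⟩ : ∃ i, n - 1 - k = i := ⟨_, rfl⟩
    have hin : n = i + (k + 1) := by omega
    have e1 : ((2 * n + 1) * (-1) + 2 * i + 1 : ℚ) = -((2 * (k + 1) : ℕ) : ℚ) := by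
      rw [hin]; push_cast; ring
    have e2 : ((2 * n + 1) * (-1) + 2 * ((n + 1 + k : ℕ) : ℚ) + 1 : ℚ) =
        ((2 * (k + 1) : ℕ) : ℚ) := by
      push_cast; ring
    have e3 : (-1 : ℚ) ^ i = (-1) ^ n * (-1) ^ (k + 1) := by
      rw [hin, pow_add, mul_assoc, ← pow_add, Even.neg_one_pow ⟨k + 1, rfl⟩, mul_one]
    rw [hi, e1, e2, e3, heven.neg_pow]
    ring
  rw [hsum] at htel
  have hinv : RatCong p 1
      ((-1) ^ n * ∑ k ∈ range n, (-1) ^ (k + 1) * 2 * ((2 * (k + 1) : ℕ) : ℚ) ^ (p - 3))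
      ((-1) ^ n * ∑ k ∈ range n, (-1) ^ (k + 1) * 2 * ((2 * (k + 1) : ℕ) : ℚ)⁻¹ ^ 2) := by
    refine RatCong.mul_left (pow_mem (neg_mem (one_mem _)) _) (.sum fun k hk => ?_)
    have hk := mem_range.mp hk
    exact (natCast_pow_sub_three_ratCong h3 (by omega) (by omega)).mul_left
      (mul_mem (pow_mem (neg_mem (one_mem _)) _) (natCast_mem (pIntegral p) 2))
  have e : (2 : ℚ)⁻¹ * (eulerFunctional ((X + C ((p : ℚ) * (-1))) ^ (p - 3)) +
      eulerFunctional ((X + C ((p : ℚ) * 1)) ^ (p - 3))) =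
      (-1) ^ n * ∑ k ∈ range n, (-1) ^ (k + 1) * 2 * ((2 * (k + 1) : ℕ) : ℚ) ^ (p - 3) := by
    linear_combination -(2 : ℚ)⁻¹ * htel
  rw [e] at hE
  convert hE.symm.trans hinv using 1
  · ring
  · rw [sum_div]
    congr 1
    refine sum_congr rfl fun k _ => ?_
    push_cast
    field_simp

end EulerCongruence

/-- For a prime `p > 3`,
`p ∑_{j=0}^{(p-3)/2} C(2j,j)/4^j (1 + p H_{2j} - p H_j)/(2j+1)
  ≡ (-1)^((p+1)/2) p q_p(2) + (-1)^((p+1)/2) 2 p^2 q_p(2)^2 - p^2 E_{p-3} (mod p^3)`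
as rational numbers, where `q_p(2) = (2^{p-1} - 1)/p` is the Fermat quotient. -/
theorem S1_congruence (p : ℕ) (hp : p.Prime) (hp3 : 3 < p) :
    ((p : ℤ)) ^ 3 ∣
      (((p : ℚ) * ∑ j ∈ Finset.range ((p - 3) / 2 + 1),
          ((2 * j).choose j : ℚ) / 4 ^ j *
            (1 + (p : ℚ) * harmonic (2 * j) - (p : ℚ) * harmonic j) / (2 * (j : ℚ) + 1)) -
        ((-1) ^ ((p + 1) / 2) * (p : ℚ) * (((2 : ℚ) ^ (p - 1) - 1) / (p : ℚ)) +
          (-1) ^ ((p + 1) / 2) * 2 * (p : ℚ) ^ 2 * (((2 : ℚ) ^ (p - 1) - 1) / (p : ℚ)) ^ 2 -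
          (p : ℚ) ^ 2 * eulerNumber (p - 3))).num := by
  have : Fact p.Prime := ⟨hp⟩
  obtain ⟨n, hn⟩ := hp.odd_of_ne_two (by omega)
  rw [show (p - 3) / 2 + 1 = n by omega, show (p + 1) / 2 = n + 1 by omega]
  set q : ℚ := ((2 : ℚ) ^ (p - 1) - 1) / p with hqdef
  have hq : (4 : ℚ) ^ n = 1 + p * q := by
    have hp0 : (p : ℚ) ≠ 0 := ratCast_natCast_ne_zero
    rw [hqdef, show p - 1 = 2 * n by omega, pow_mul]
    field_simp
    norm_num
  have hterms := RatCong.sum (s := range n) fun j hj => summand_ratCong hn (mem_range.mp hj)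
  rw [sum_add_distrib, ← mul_sum] at hterms
  have hmain := sum_signed_choose_div_odd_ratCong hn hp3 hq
  have hfirst := (sum_signed_choose_mul_harmonic_ratCong hn hp3 hq).add
    (eulerNumber_sub_three_ratCong hn hp3)
  have hfirst' : RatCong p 1
      (∑ j ∈ range n, (-1) ^ j * (n.choose j : ℚ) / (2 * j + 1) *
        (2 * oddHarmonic j - harmonic j / 2))
      (-(-1) ^ n * (3 * q ^ 2) - eulerNumber (p - 3)) := by
    convert hfirst.sub (.refl (eulerNumber (p - 3))) using 1 <;> ring
  have htotal := (hterms.trans (hmain.add hfirst'.prime_mul)).prime_mul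
  convert htotal.dvd_num using 3
  · rfl
  · rw [pow_succ]
    ring
end

section
/- Let p > 3 be a prime. Then (-1)^((p-1)/2) * binom(p-1, (p-1)/2) − 2^{p-1} ≡ p * q_p(2) modulo p^2, where q_p(2) = (2^{p-1} − 1)/p is the Fermat quotient of 2. -/
/-- Partial alternating sums of a row of Pascal's triangle telescope. -/
lemma sum_range_alternating_choose_succ (n m : ℕ) :
    ∑ i ∈ Finset.range (m + 1), (-1 : ℤ) ^ i * ((n + 1).choose i : ℤ) =
      (-1) ^ m * (n.choose m : ℤ) := by
  induction m with
  | zero => simp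
  | succ m ih =>
    rw [Finset.sum_range_succ, ih, Nat.choose_succ_succ]
    push_cast
    ring

/-- Partial sums of the even-indexed entries of a row of Pascal's triangle are partial sums of the
previous row. -/
lemma sum_range_choose_succ_two_mul (n m : ℕ) :
    ∑ i ∈ Finset.range (m + 1), (n + 1).choose (2 * i) =
      ∑ k ∈ Finset.range (2 * m + 1), n.choose k := by
  induction m with
  | zero => simp
  | succ m ih =>
    rw [Finset.sum_range_succ, ih, show 2 * (m + 1) + 1 = 2 * m + 1 + 1 + 1 by ring,
      Finset.sum_range_succ _ (2 * m + 1 + 1), Finset.sum_range_succ _ (2 * m + 1),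
      show 2 * (m + 1) = 2 * m + 1 + 1 by ring, Nat.choose_succ_succ]
    ring

lemma Nat.Prime.choose_pred_modEq {n : ℕ} (hp : (n + 1).Prime) {k : ℕ} (hk : k ≤ n) :
    (n.choose k : ℤ) ≡ (-1) ^ k [ZMOD (n + 1 : ℕ)] := by
  induction k with
  | zero => simp [Int.ModEq.refl]
  | succ k ih =>
    have hdvd : ((n + 1 : ℕ) : ℤ) ∣ ((n + 1).choose (k + 1) : ℕ) :=
      Int.natCast_dvd_natCast.mpr (hp.dvd_choose_self (by omega) (by omega))
    have hsum := (Int.modEq_zero_iff_dvd.mpr hdvd).sub (ih (by omega))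
    rw [Nat.choose_succ_succ] at hsum
    convert hsum using 1
    · push_cast; ring
    · ring

lemma Nat.Prime.mul_choose_modEq {n : ℕ} (hp : (n + 1).Prime) {k : ℕ} (hk : k ≤ n) :
    ((k + 1 : ℕ) : ℤ) * ((n + 1).choose (k + 1) : ℤ) ≡
      ((n + 1 : ℕ) : ℤ) * (-1) ^ k [ZMOD ((n + 1 : ℕ) : ℤ) ^ 2] := by
  have habs : ((k + 1 : ℕ) : ℤ) * ((n + 1).choose (k + 1) : ℤ) =
      ((n + 1 : ℕ) : ℤ) * (n.choose k : ℤ) := by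
    have := Nat.add_one_mul_choose_eq n k
    rw [mul_comm]
    exact_mod_cast this.symm
  rw [habs, sq]
  exact (hp.choose_pred_modEq hk).mul_left'

lemma Nat.Prime.alternating_choose_modEq_two_mul_choose {n : ℕ} (hp : (n + 1).Prime) {k : ℕ}
    (hk : 2 * k + 1 ≤ n) :
    (-1) ^ (k + 1) * ((n + 1).choose (k + 1) : ℤ) ≡
      2 * ((n + 1).choose (2 * (k + 1)) : ℤ) [ZMOD ((n + 1 : ℕ) : ℤ) ^ 2] := by
  have hcop : IsCoprime (((n + 1 : ℕ) : ℤ) ^ 2) ((k + 1 : ℕ) : ℤ) := by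
    apply IsCoprime.pow_left
    rw [Nat.isCoprime_iff_coprime]
    exact Nat.coprime_of_lt_prime (by omega) (by omega) hp
  have hsingle := (hp.mul_choose_modEq (show k ≤ n by omega)).mul_left ((-1) ^ (k + 1))
  have hdouble := hp.mul_choose_modEq hk
  have hpow : ((-1 : ℤ) ^ k) * (-1) ^ k = 1 := by
    rw [← mul_pow]; simp
  have hodd : (-1 : ℤ) ^ (2 * k + 1) = -1 := by
    rw [pow_succ, pow_mul]; simp
  have hdvd := (hdouble.sub hsingle).dvd
  rw [hodd] at hdvd
  apply (Int.modEq_iff_dvd).mpr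
  apply hcop.dvd_of_dvd_mul_left
  rw [← dvd_neg]
  refine hdvd.trans (dvd_of_eq ?_)
  rw [show 2 * (k + 1) = 2 * k + 1 + 1 by ring]
  push_cast
  linear_combination ((n : ℤ) + 1) * hpow

/-- For a prime `p > 3`,
`(-1)^((p-1)/2) C(p-1,(p-1)/2) - 2^{p-1} ≡ p q_p(2) (mod p^2)` as integers,
where `q_p(2) = (2^{p-1} - 1)/p` is the Fermat quotient (an integer by Fermat's
little theorem, so the integer division below is exact). -/
theorem morley_fermat_quotient (p : ℕ) (hp : p.Prime) (hp3 : 3 < p) :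
    (-1) ^ ((p - 1) / 2) * ((p - 1).choose ((p - 1) / 2) : ℤ) - 2 ^ (p - 1) ≡
      (p : ℤ) * ((2 ^ (p - 1) - 1) / (p : ℤ)) [ZMOD (p : ℤ) ^ 2] := by
  have hfermat : (p : ℤ) ∣ 2 ^ (p - 1) - 1 := by
    refine (Int.ModEq.pow_card_sub_one_eq_one hp ?_).symm.dvd
    exact_mod_cast Nat.isCoprime_iff_coprime.mpr
      (Nat.coprime_of_lt_prime (n := 2) (by omega) (by omega) hp).symm
  rw [Int.mul_ediv_cancel' hfermat]
  obtain ⟨m, rfl⟩ := hp.odd_of_ne_two (by omega)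
  rw [Nat.add_sub_cancel, Nat.mul_div_cancel_left m two_pos]
  have hterms : ∑ i ∈ Finset.range m, (-1 : ℤ) ^ (i + 1) * ((2 * m + 1).choose (i + 1) : ℤ) ≡
      ∑ i ∈ Finset.range m, 2 * ((2 * m + 1).choose (2 * (i + 1)) : ℤ)
        [ZMOD ((2 * m + 1 : ℕ) : ℤ) ^ 2] :=
    Int.ModEq.sum fun i hi ↦ hp.alternating_choose_modEq_two_mul_choose
      (by have := Finset.mem_range.mp hi; omega)
  have halt := sum_range_alternating_choose_succ (2 * m) m
  have heven := congrArg (Nat.cast (R := ℤ)) (sum_range_choose_succ_two_mul (2 * m) m)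
  rw [Nat.sum_range_choose] at heven
  rw [Finset.sum_range_succ'] at halt heven
  push_cast at halt heven
  rw [← Finset.mul_sum] at hterms
  have hresult := hterms.add_right (1 - 2 ^ (2 * m))
  convert hresult using 1
  · rw [← halt]; simp; ring
  · rw [← heven]; simp; ring
end
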